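/- Let μ be a Borel measure on ℝ^d with 0 < μ(ℝ^d) < ∞. Then the lower Hausdorff dimension of μ equals the essential infimum, with respect to μ, of the lower local dimension x ↦ liminf_{r→0} log μ(B(x,r))/log r, and the upper Hausdorff dimension of μ equals the essential supremum, with respect to μ, of the lower local dimension. -/

import Mathlib

open MeasureTheory Filter Set
open scoped ENNReal

/-- The lower local dimension of a measure `μ` at a point `x`:
`liminf_{r→0⁺} log μ(B(x,r)) / log r`. -/
noncomputable def lowerLocalDim {d : ℕ} (μ : Measure (EuclideanSpace ℝ (Fin d)))
    (x : EuclideanSpace ℝ (Fin d)) : ℝ :=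
  liminf (fun r : ℝ => Real.log (μ (Metric.closedBall x r)).toReal / Real.log r)
    (nhdsWithin 0 (Set.Ioi 0))

/-- The lower Hausdorff dimension of `μ`: `inf {dim_H A : A Borel, μ A > 0}`. -/
noncomputable def lowerDimMeasure {d : ℕ} (μ : Measure (EuclideanSpace ℝ (Fin d))) : ℝ≥0∞ :=
  sInf (dimH '' {A : Set (EuclideanSpace ℝ (Fin d)) | MeasurableSet A ∧ 0 < μ A})

/-- The upper Hausdorff dimension of `μ`: `inf {dim_H A : A Borel, μ Aᶜ = 0}`. -/
noncomputable def upperDimMeasure {d : ℕ} (μ : Measure (EuclideanSpace ℝ (Fin d))) : ℝ≥0∞ :=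
  sInf (dimH '' {A : Set (EuclideanSpace ℝ (Fin d)) | MeasurableSet A ∧ μ Aᶜ = 0})

open scoped NNReal Topology

section HausdorffMeasure

variable {X : Type*} [MetricSpace X] [MeasurableSpace X] [BorelSpace X]

/-- **Mass distribution principle**, uniform version. -/
theorem measure_le_hausdorffMeasure_of_closedBall_le {μ : Measure X} {s : ℝ≥0}
    {A : Set X} {δ : ℝ} (hδ : 0 < δ)
    (hA : ∀ x ∈ A, ∀ r : ℝ, 0 < r → r < δ →
      μ (Metric.closedBall x r) ≤ ENNReal.ofReal r ^ (s : ℝ)) :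
    μ A ≤ Measure.hausdorffMeasure (s : ℝ) A := by
  have key : μ.restrict A ≤ Measure.hausdorffMeasure (s : ℝ) := by
    refine Measure.le_hausdorffMeasure _ _ (ENNReal.ofReal (δ / 2)) (by simpa using hδ)
      fun t ht => ?_
    refine (measure_mono (subset_closure (s := t))).trans ?_
    rw [Measure.restrict_apply isClosed_closure.measurableSet, ← Metric.ediam_closure t]
    rw [← Metric.ediam_closure t] at ht
    rcases (closure t ∩ A).eq_empty_or_nonempty with h | ⟨x, hxt, hxA⟩
    · simp [h]
    have hfin : Metric.ediam (closure t) ≠ ∞ := ne_top_of_le_ne_top ENNReal.ofReal_ne_top ht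
    have hdiam : Metric.diam (closure t) ≤ δ / 2 := ENNReal.toReal_le_of_le_ofReal (by positivity) ht
    have hball : ∀ r : ℝ, Metric.diam (closure t) < r → r < δ →
        μ (closure t ∩ A) ≤ ENNReal.ofReal r ^ (s : ℝ) := by
      intro r hr hrδ
      refine (measure_mono ?_).trans (hA x hxA r (Metric.diam_nonneg.trans_lt hr) hrδ)
      rintro y ⟨hy, -⟩
      exact (Metric.dist_le_diam_of_mem' hfin hy hxt).trans hr.le
    have hlim : Tendsto (fun r : ℝ => ENNReal.ofReal r ^ (s : ℝ))
        (𝓝[>] Metric.diam (closure t)) (𝓝 (ENNReal.ofReal (Metric.diam (closure t)) ^ (s : ℝ))) :=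
      ((ENNReal.continuous_rpow_const.comp ENNReal.continuous_ofReal).tendsto _).mono_left
        nhdsWithin_le_nhds
    rw [Metric.diam, ENNReal.ofReal_toReal hfin] at hlim
    refine ge_of_tendsto hlim ?_
    filter_upwards [Ioo_mem_nhdsGT (show Metric.diam (closure t) < δ by linarith)] with r hr
    exact hball r hr.1 hr.2
  simpa using key A

/-- **Mass distribution principle**: a set of positive measure on which the balls eventually
satisfy `μ (B(x,r)) ≤ r ^ s` has Hausdorff dimension at least `s`. -/
theorem le_dimH_of_eventually_closedBall_le {μ : Measure X} {s : ℝ≥0} {A : Set X} (hμA : μ A ≠ 0)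
    (hA : ∀ x ∈ A, ∀ᶠ r in 𝓝[>] (0 : ℝ),
      μ (Metric.closedBall x r) ≤ ENNReal.ofReal r ^ (s : ℝ)) :
    (s : ℝ≥0∞) ≤ dimH A := by
  let P : ℕ → Set X := fun n => {x ∈ A | ∀ r : ℝ, 0 < r → r < 1 / ((n : ℝ) + 1) →
      μ (Metric.closedBall x r) ≤ ENNReal.ofReal r ^ (s : ℝ)}
  have hcover : A ⊆ ⋃ n, P n := by
    intro x hx
    obtain ⟨δ, hδ, hball⟩ := mem_nhdsGT_iff_exists_Ioo_subset.1 (hA x hx)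
    obtain ⟨n, hn⟩ := exists_nat_one_div_lt (show (0 : ℝ) < δ from hδ)
    exact mem_iUnion.2 ⟨n, hx, fun r hr hrn => hball ⟨hr, hrn.trans hn⟩⟩
  obtain ⟨n, hn⟩ : ∃ n, μ (P n) ≠ 0 := by
    by_contra! h
    exact hμA (measure_mono_null hcover (measure_iUnion_null h))
  have hle : μ (P n) ≤ Measure.hausdorffMeasure (s : ℝ) (P n) :=
    measure_le_hausdorffMeasure_of_closedBall_le (δ := 1 / ((n : ℝ) + 1)) (by positivity)
      fun x hx => hx.2
  have hPA : P n ⊆ A := fun x hx => hx.1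
  borelize X
  refine (le_dimH_of_hausdorffMeasure_ne_zero fun h => hn ?_).trans (dimH_mono hPA)
  exact le_antisymm (hle.trans h.le) bot_le

/-- If `μ (B(x,r)) ≥ r ^ s` for arbitrarily small `r` at every point of `A`, then `A` has finite
`s`-dimensional Hausdorff measure. -/
theorem hausdorffMeasure_lt_top_of_frequently_le_closedBall [SecondCountableTopology X]
    {μ : Measure X} [IsFiniteMeasure μ] {s : ℝ≥0} {A : Set X}
    (hA : ∀ x ∈ A, ∃ᶠ r in 𝓝[>] (0 : ℝ),
      ENNReal.ofReal r ^ (s : ℝ) ≤ μ (Metric.closedBall x r)) :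
    Measure.hausdorffMeasure (s : ℝ) A < ∞ := by
  have hsmall : ∀ (n : ℕ) (x : X), ∃ r : ℝ, x ∈ A → 0 < r ∧ r < 1 / ((n : ℝ) + 1) ∧
      ENNReal.ofReal r ^ (s : ℝ) ≤ μ (Metric.closedBall x r) := by
    intro n x
    by_cases hx : x ∈ A
    · obtain ⟨r, hr, hr'⟩ := ((hA x hx).and_eventually
        (Ioo_mem_nhdsGT (show (0 : ℝ) < 1 / ((n : ℝ) + 1) by positivity))).exists
      exact ⟨r, fun _ => ⟨hr'.1, hr'.2, hr⟩⟩
    · exact ⟨0, fun h => absurd h hx⟩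
  choose ρ hρ using hsmall
  have hvitali := fun n : ℕ => Vitali.exists_disjoint_subfamily_covering_enlargement_closedBall
    A (fun x : X => x) (ρ n) 1 (fun x hx => ((hρ n x hx).2.1.le.trans
      (by rw [div_le_one (by positivity)]; linarith [n.cast_nonneg (α := ℝ)]))) 5 (by norm_num)
  choose u huA hdisj hcover using hvitali
  have hcount : ∀ n, (u n).Countable := fun n =>
    (hdisj n).countable_of_nonempty_interior fun x hx =>
      ⟨x, Metric.ball_subset_interior_closedBall
        (Metric.mem_ball_self (hρ n x (huA n hx)).1)⟩
  have : ∀ n, Countable (u n) := fun n => (hcount n).to_subtype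
  have hediam : ∀ n, ∀ x : u n, Metric.ediam (Metric.closedBall (x : X) (5 * ρ n x)) ≤
      10 * ENNReal.ofReal (ρ n x) := by
    intro n x
    have hpos := (hρ n x (huA n x.2)).1
    rw [← Metric.closedEBall_ofReal (by positivity)]
    refine Metric.ediam_closedEBall_le.trans_eq ?_
    rw [ENNReal.ofReal_mul (by norm_num), ← mul_assoc]
    norm_num
  have hbound : ∀ n, ∑' x : u n, Metric.ediam (Metric.closedBall (x : X) (5 * ρ n x)) ^ (s : ℝ) ≤
      10 ^ (s : ℝ) * μ univ := by
    intro n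
    calc ∑' x : u n, Metric.ediam (Metric.closedBall (x : X) (5 * ρ n x)) ^ (s : ℝ)
        ≤ ∑' x : u n, 10 ^ (s : ℝ) * μ (Metric.closedBall (x : X) (ρ n x)) := by
          refine ENNReal.tsum_le_tsum fun x => ?_
          refine (ENNReal.rpow_le_rpow (hediam n x) s.2).trans ?_
          rw [ENNReal.mul_rpow_of_nonneg _ _ s.2]
          exact mul_le_mul_right (hρ n x (huA n x.2)).2.2 _
      _ = 10 ^ (s : ℝ) * μ (⋃ x ∈ u n, Metric.closedBall x (ρ n x)) := by
          rw [ENNReal.tsum_mul_left, measure_biUnion (hcount n) (hdisj n)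
            fun x _ => Metric.isClosed_closedBall.measurableSet]
      _ ≤ 10 ^ (s : ℝ) * μ univ := by gcongr; exact subset_univ _
  have hle := Measure.hausdorffMeasure_le_liminf_tsum (ι := fun n => u n) (s : ℝ) A (l := atTop)
    (fun n : ℕ => ENNReal.ofReal (10 * (1 / ((n : ℝ) + 1))))
    (by
      have := (tendsto_one_div_add_atTop_nhds_zero_nat (𝕜 := ℝ)).const_mul 10
      simpa using ENNReal.tendsto_ofReal this)
    (fun n x => Metric.closedBall (x : X) (5 * ρ n x))
    (Eventually.of_forall fun n x => (hediam n x).trans (by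
      rw [ENNReal.ofReal_mul (by norm_num), ENNReal.ofReal_ofNat]
      gcongr
      exact (hρ n x (huA n x.2)).2.1.le))
    (Eventually.of_forall fun n x hx => by
      obtain ⟨y, hy, hxy⟩ := hcover n x hx
      exact mem_iUnion.2 ⟨⟨y, hy⟩, hxy (Metric.mem_closedBall_self (hρ n x hx).1.le)⟩)
  refine hle.trans_lt (lt_of_le_of_lt (liminf_le_of_le (a := 10 ^ (s : ℝ) * μ univ)
    (by isBoundedDefault) fun b hb => ?_)
    (ENNReal.mul_lt_top (ENNReal.rpow_lt_top_of_nonneg s.2 (by simp)) (measure_lt_top μ _)))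
  obtain ⟨n, hn⟩ := hb.exists
  exact hn.trans (hbound n)

/-- A set of finite `s`-dimensional Hausdorff measure is contained in a Borel set of Hausdorff
dimension at most `s`. -/
theorem exists_measurableSet_superset_dimH_le {s : ℝ≥0} {A : Set X}
    (hA : Measure.hausdorffMeasure (s : ℝ) A < ∞) :
    ∃ B, A ⊆ B ∧ MeasurableSet B ∧ dimH B ≤ s := by
  refine ⟨toMeasurable (Measure.hausdorffMeasure (s : ℝ)) A, subset_toMeasurable _ _,
    measurableSet_toMeasurable _ _, ?_⟩
  borelize X
  refine dimH_le_of_hausdorffMeasure_ne_top ?_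
  rw [measure_toMeasurable]
  exact hA.ne

end HausdorffMeasure

theorem lt_of_ofReal_lt_coe {a : ℝ} {s : ℝ≥0} (h : ENNReal.ofReal a < s) : a < s :=
  lt_of_not_ge fun hle => h.not_ge (by simpa using ENNReal.ofReal_le_ofReal hle)

section LowerLocalDim

variable {d : ℕ} {μ : Measure (EuclideanSpace ℝ (Fin d))}

/-- At these points the real-valued lower limit defining `lowerLocalDim` is a genuine one. -/
structure IsRegularPoint (μ : Measure (EuclideanSpace ℝ (Fin d)))
    (x : EuclideanSpace ℝ (Fin d)) : Prop where
  mem_support : x ∈ μ.support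
  frequently : ∃ᶠ r in 𝓝[>] (0 : ℝ),
    ENNReal.ofReal r ^ ((d + 1 : ℝ≥0) : ℝ) ≤ μ (Metric.closedBall x r)

theorem ae_isRegularPoint : ∀ᵐ x ∂μ, IsRegularPoint μ x := by
  have hfreq : ∀ᵐ x ∂μ, ∃ᶠ r in 𝓝[>] (0 : ℝ),
      ENNReal.ofReal r ^ ((d + 1 : ℝ≥0) : ℝ) ≤ μ (Metric.closedBall x r) := by
    rw [ae_iff]
    by_contra hne
    have hle := le_dimH_of_eventually_closedBall_le (s := d + 1) hne fun x hx =>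
      (not_frequently.1 hx).mono fun r hr => (not_le.1 hr).le
    have hd := hle.trans (dimH_mono (subset_univ _))
    rw [Real.dimH_univ_eq_finrank, finrank_euclideanSpace_fin] at hd
    have : ((d + 1 : ℝ≥0)) ≤ d := by exact_mod_cast hd
    exact absurd this (by simp)
  filter_upwards [hfreq, Measure.support_mem_ae (μ := μ)] with x hx hxs
  exact ⟨hxs, hx⟩

variable [IsFiniteMeasure μ] {x : EuclideanSpace ℝ (Fin d)}

theorem eventually_neg_le_log_measure_closedBall_div_log {ε : ℝ} (hε : 0 < ε) :
    ∀ᶠ r in 𝓝[>] (0 : ℝ), -ε ≤ Real.log (μ (Metric.closedBall x r)).toReal / Real.log r := by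
  have hlim : Tendsto (fun r => Real.log (μ.real univ + 1) / Real.log r) (𝓝[>] (0 : ℝ)) (𝓝 0) :=
    Real.tendsto_log_nhdsGT_zero.const_div_atBot _
  filter_upwards [hlim.eventually (lt_mem_nhds (neg_lt_zero.2 hε)),
    Ioo_mem_nhdsGT (zero_lt_one (α := ℝ))] with r hr hr1
  refine hr.le.trans (div_le_div_of_nonpos_of_le (Real.log_neg hr1.1 hr1.2).le ?_)
  have hle : (μ (Metric.closedBall x r)).toReal ≤ μ.real univ :=
    measureReal_mono (subset_univ _)
  rcases (ENNReal.toReal_nonneg (a := μ (Metric.closedBall x r))).eq_or_lt with h | h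
  · rw [← h, Real.log_zero]
    exact Real.log_nonneg (by linarith [measureReal_nonneg (μ := μ) (s := univ)])
  · exact Real.log_le_log h (by linarith)

theorem eventually_closedBall_le_of_lt_lowerLocalDim {s : ℝ≥0} (hs : (s : ℝ) < lowerLocalDim μ x) :
    ∀ᶠ r in 𝓝[>] (0 : ℝ), μ (Metric.closedBall x r) ≤ ENNReal.ofReal r ^ (s : ℝ) := by
  filter_upwards [eventually_lt_of_lt_liminf hs
    ⟨_, eventually_map.2 (eventually_neg_le_log_measure_closedBall_div_log one_pos)⟩,
    Ioo_mem_nhdsGT (zero_lt_one (α := ℝ))] with r hr hr1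
  rcases eq_or_ne (μ (Metric.closedBall x r)) 0 with h | h
  · simp [h]
  rw [lt_div_iff_of_neg (Real.log_neg hr1.1 hr1.2), ← Real.log_rpow hr1.1] at hr
  rw [ENNReal.ofReal_rpow_of_pos hr1.1,
    ENNReal.le_ofReal_iff_toReal_le (measure_ne_top _ _) (Real.rpow_nonneg hr1.1.le _)]
  exact ((Real.log_lt_log_iff (ENNReal.toReal_pos h (measure_ne_top _ _))
    (Real.rpow_pos_of_pos hr1.1 _)).1 hr).le

theorem log_measure_closedBall_div_log_le {t r : ℝ} (hr : r ∈ Ioo (0 : ℝ) 1)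
    (h : ENNReal.ofReal r ^ t ≤ μ (Metric.closedBall x r)) :
    Real.log (μ (Metric.closedBall x r)).toReal / Real.log r ≤ t := by
  rw [div_le_iff_of_neg (Real.log_neg hr.1 hr.2), ← Real.log_rpow hr.1]
  rw [ENNReal.ofReal_rpow_of_pos hr.1,
    ENNReal.ofReal_le_iff_le_toReal (measure_ne_top _ _)] at h
  exact Real.log_le_log (Real.rpow_pos_of_pos hr.1 _) h

namespace IsRegularPoint

theorem frequently_div_le (hx : IsRegularPoint μ x) : ∃ᶠ r in 𝓝[>] (0 : ℝ),
    Real.log (μ (Metric.closedBall x r)).toReal / Real.log r ≤ ((d + 1 : ℝ≥0) : ℝ) :=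
  (hx.frequently.and_eventually (Ioo_mem_nhdsGT (zero_lt_one (α := ℝ)))).mono fun _ hr =>
    log_measure_closedBall_div_log_le hr.2 hr.1

theorem isCoboundedUnder (hx : IsRegularPoint μ x) : IsCoboundedUnder (· ≥ ·) (𝓝[>] (0 : ℝ))
    fun r => Real.log (μ (Metric.closedBall x r)).toReal / Real.log r :=
  IsCoboundedUnder.of_frequently_le hx.frequently_div_le

theorem lowerLocalDim_nonneg (hx : IsRegularPoint μ x) : 0 ≤ lowerLocalDim μ x :=
  le_of_forall_pos_le_add fun ε hε => by
    have := le_liminf_of_le hx.isCoboundedUnder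
      (eventually_neg_le_log_measure_closedBall_div_log (μ := μ) (x := x) hε)
    rw [lowerLocalDim]
    linarith

theorem lowerLocalDim_le (hx : IsRegularPoint μ x) :
    lowerLocalDim μ x ≤ ((d + 1 : ℝ≥0) : ℝ) :=
  liminf_le_of_frequently_le hx.frequently_div_le
    ⟨_, eventually_map.2 (eventually_neg_le_log_measure_closedBall_div_log one_pos)⟩

theorem frequently_le_closedBall (hx : IsRegularPoint μ x) {s : ℝ≥0}
    (hs : lowerLocalDim μ x < s) : ∃ᶠ r in 𝓝[>] (0 : ℝ),
      ENNReal.ofReal r ^ (s : ℝ) ≤ μ (Metric.closedBall x r) := by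
  refine ((frequently_lt_of_liminf_lt hx.isCoboundedUnder hs).and_eventually
    (Ioo_mem_nhdsGT (zero_lt_one (α := ℝ)))).mono fun r ⟨hr, hr1⟩ => ?_
  have hpos := (Measure.mem_support_iff_forall x).1 hx.mem_support _
    (Metric.closedBall_mem_nhds x hr1.1)
  rw [div_lt_iff_of_neg (Real.log_neg hr1.1 hr1.2), ← Real.log_rpow hr1.1] at hr
  rw [ENNReal.ofReal_rpow_of_pos hr1.1, ENNReal.ofReal_le_iff_le_toReal (measure_ne_top _ _)]
  exact ((Real.log_lt_log_iff (Real.rpow_pos_of_pos hr1.1 _)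
    (ENNReal.toReal_pos hpos.ne' (measure_ne_top _ _))).1 hr).le

end IsRegularPoint

theorem isBoundedUnder_ge_lowerLocalDim : IsBoundedUnder (· ≥ ·) (ae μ) (lowerLocalDim μ) :=
  ⟨0, eventually_map.2 (ae_isRegularPoint.mono fun _ hx => hx.lowerLocalDim_nonneg)⟩

theorem isBoundedUnder_le_lowerLocalDim : IsBoundedUnder (· ≤ ·) (ae μ) (lowerLocalDim μ) :=
  ⟨_, eventually_map.2 (ae_isRegularPoint.mono fun _ hx => hx.lowerLocalDim_le)⟩

theorem le_dimH_of_frequently_lt_lowerLocalDim {s : ℝ≥0} {A : Set (EuclideanSpace ℝ (Fin d))}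
    (h : ∃ᶠ x in ae μ, x ∈ A ∧ (s : ℝ) < lowerLocalDim μ x) : (s : ℝ≥0∞) ≤ dimH A :=
  (le_dimH_of_eventually_closedBall_le (frequently_ae_iff.1 h) fun _ hx =>
    eventually_closedBall_le_of_lt_lowerLocalDim hx.2).trans (dimH_mono fun _ hx => hx.1)

theorem exists_measurableSet_dimH_le_of_lowerLocalDim_lt (μ : Measure (EuclideanSpace ℝ (Fin d)))
    [IsFiniteMeasure μ] (s : ℝ≥0) :
    ∃ B, MeasurableSet B ∧ dimH B ≤ s ∧ ∀ᵐ x ∂μ, lowerLocalDim μ x < s → x ∈ B := by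
  obtain ⟨B, hAB, hB, hdim⟩ := exists_measurableSet_superset_dimH_le
    (hausdorffMeasure_lt_top_of_frequently_le_closedBall (μ := μ) (s := s)
      (A := {x | IsRegularPoint μ x ∧ lowerLocalDim μ x < s}) fun x hx =>
        hx.1.frequently_le_closedBall hx.2)
  exact ⟨B, hB, hdim, ae_isRegularPoint.mono fun x hx hlt => hAB ⟨hx, hlt⟩⟩

theorem lowerDimMeasure_eq [NeZero μ] :
    lowerDimMeasure μ = ENNReal.ofReal (essInf (lowerLocalDim μ) μ) := by
  refine le_antisymm (le_of_forall_gt fun c hc => ?_) (le_sInf ?_)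
  · obtain ⟨s, hs, hsc⟩ := ENNReal.lt_iff_exists_nnreal_btwn.1 hc
    obtain ⟨B, hB, hdim, hmem⟩ := exists_measurableSet_dimH_le_of_lowerLocalDim_lt μ s
    have hfreq := frequently_lt_of_liminf_lt
      isBoundedUnder_le_lowerLocalDim.isCoboundedUnder_ge
      (lt_of_ofReal_lt_coe hs)
    have hpos : μ B ≠ 0 := frequently_ae_mem_iff.1 ((hfreq.and_eventually hmem).mono
      fun x hx => hx.2 hx.1)
    have hle : lowerDimMeasure μ ≤ dimH B := sInf_le ⟨B, ⟨hB, pos_iff_ne_zero.2 hpos⟩, rfl⟩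
    exact hle.trans_lt (hdim.trans_lt hsc)
  · rintro _ ⟨A, ⟨-, hA⟩, rfl⟩
    refine ENNReal.le_of_forall_nnreal_lt fun s hs => ?_
    have hae := eventually_lt_of_lt_liminf (ENNReal.coe_lt_ofReal.1 hs)
      isBoundedUnder_ge_lowerLocalDim
    exact le_dimH_of_frequently_lt_lowerLocalDim
      ((frequently_ae_mem_iff.2 hA.ne').and_eventually hae)

theorem upperDimMeasure_eq [NeZero μ] :
    upperDimMeasure μ = ENNReal.ofReal (essSup (lowerLocalDim μ) μ) := by
  refine le_antisymm (le_of_forall_gt fun c hc => ?_) (le_sInf ?_)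
  · obtain ⟨s, hs, hsc⟩ := ENNReal.lt_iff_exists_nnreal_btwn.1 hc
    obtain ⟨B, hB, hdim, hmem⟩ := exists_measurableSet_dimH_le_of_lowerLocalDim_lt μ s
    have hae := eventually_lt_of_limsup_lt (lt_of_ofReal_lt_coe hs)
      isBoundedUnder_le_lowerLocalDim
    have hnull : μ Bᶜ = 0 := by
      filter_upwards [hae, hmem] with x hx hxB using hxB hx
    have hle : upperDimMeasure μ ≤ dimH B := sInf_le ⟨B, ⟨hB, hnull⟩, rfl⟩
    exact hle.trans_lt (hdim.trans_lt hsc)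
  · rintro _ ⟨A, ⟨-, hA⟩, rfl⟩
    refine ENNReal.le_of_forall_nnreal_lt fun s hs => ?_
    have hfreq := frequently_lt_of_lt_limsup
      isBoundedUnder_ge_lowerLocalDim.isCoboundedUnder_le
      (ENNReal.coe_lt_ofReal.1 hs)
    exact le_dimH_of_frequently_lt_lowerLocalDim
      ((hfreq.and_eventually (show A ∈ ae μ from hA)).mono fun x hx => hx.symm)

end LowerLocalDim

theorem stmt0 {d : ℕ} (μ : Measure (EuclideanSpace ℝ (Fin d)))
    (h0 : 0 < μ Set.univ) (hfin : μ Set.univ < ⊤) :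
    lowerDimMeasure μ = ENNReal.ofReal (essInf (lowerLocalDim μ) μ) ∧
    upperDimMeasure μ = ENNReal.ofReal (essSup (lowerLocalDim μ) μ) := by
  have : IsFiniteMeasure μ := ⟨hfin⟩
  have : NeZero μ := ⟨fun h => by simp [h] at h0⟩
  exact ⟨lowerDimMeasure_eq, upperDimMeasure_eq⟩
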